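/- The interval I_str(Λ) has the cardinality of the continuum (2^{ℵ₀}), where Λ is the total clone on 𝟚 generated by the binary conjunction ∧ and the constant functions c_0, c_1. -/

import Mathlib

namespace StrongPartial

/-- Partial functions of arity `n+1` on `A` (arities are `≥ 1`).
`f.2 x = some a` means `x ∈ dom f` with value `a`; `f.2 x = none` means `x ∉ dom f`. -/
def PF (A : Type) : Type := Σ n : ℕ, (Fin (n+1) → A) → Option A

variable {A : Type}

/-- `f` is a total function. -/
def IsTotalPF (f : PF A) : Prop := ∀ x, (f.2 x).isSome

/-- The set of all total functions on `A`. -/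
def OSet (A : Type) : Set (PF A) := {f | IsTotalPF f}

/-- The `(n+1)`-ary projection onto the `i`-th coordinate. -/
def proj (n : ℕ) (i : Fin (n+1)) : PF A := ⟨n, fun x => some (x i)⟩

/-- Composition of an arity-`k` partial function with `k` partial functions of arity `m`. -/
def compFun {k m : ℕ} (f : (Fin k → A) → Option A) (g : Fin k → ((Fin m → A) → Option A)) :
    (Fin m → A) → Option A :=
  fun x => if h : ∀ i, (g i x).isSome then f (fun i => (g i x).get (h i)) else none

/-- A partial clone: contains all projections and is closed under composition. -/
def IsPartialClone (X : Set (PF A)) : Prop :=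
  (∀ (n : ℕ) (i : Fin (n+1)), proj n i ∈ X) ∧
  (∀ f ∈ X, ∀ (m : ℕ) (g : Fin (f.1+1) → ((Fin (m+1) → A) → Option A)),
     (∀ i, (⟨m, g i⟩ : PF A) ∈ X) → (⟨m, compFun f.2 g⟩ : PF A) ∈ X)

/-- A total clone: a partial clone consisting of total functions. -/
def IsClone (C : Set (PF A)) : Prop := IsPartialClone C ∧ C ⊆ OSet A

/-- `f ≤ g`: `f` is a restriction (subfunction) of `g`. -/
def PFle (f g : PF A) : Prop :=
  ∃ h : f.1 = g.1, ∀ (x : Fin (f.1+1) → A) (a : A),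
    f.2 x = some a → g.2 (fun i => x (Fin.cast (by rw [h]) i)) = some a

/-- `Str X`: all restrictions of members of `X`. -/
def StrSet (X : Set (PF A)) : Set (PF A) := {f | ∃ g ∈ X, PFle f g}

/-- `X` is strong (restriction closed). -/
def IsStrong (X : Set (PF A)) : Prop := StrSet X = X

/-- `f` preserves the `h`-ary relation `ρ`. -/
def Preserves (f : PF A) {h : ℕ} (ρ : Set (Fin h → A)) : Prop :=
  ∀ (M : Fin h → Fin (f.1+1) → A) (v : Fin h → A),
    (∀ j, (fun i => M i j) ∈ ρ) → (∀ i, f.2 (M i) = some (v i)) → v ∈ ρ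

def pPolSet {h : ℕ} (ρ : Set (Fin h → A)) : Set (PF A) := {f | Preserves f ρ}

def PolSet {h : ℕ} (ρ : Set (Fin h → A)) : Set (PF A) := pPolSet ρ ∩ OSet A

/-- `f` preserves the relation pair `(ρ, ρ')`. -/
def PreservesPair (f : PF A) {h : ℕ} (ρ ρ' : Set (Fin h → A)) : Prop :=
  ∀ (M : Fin h → Fin (f.1+1) → A) (v : Fin h → A),
    (∀ j, (fun i => M i j) ∈ ρ) → (∀ i, f.2 (M i) = some (v i)) → v ∈ ρ'

def cPolSet {h : ℕ} (ρ ρ' : Set (Fin h → A)) : Set (PF A) := {f | PreservesPair f ρ ρ'}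

/-- The interval `I_str(C)` of strong partial clones with total part `C`. -/
def Istr (C : Set (PF A)) : Set (Set (PF A)) :=
  {X | IsPartialClone X ∧ IsStrong X ∧ X ∩ OSet A = C}

/-! Maltsev operations -/

def zeta (f : PF A) : PF A := ⟨f.1, fun x => f.2 (fun i => x (i + 1))⟩

def tau (f : PF A) : PF A := ⟨f.1, fun x => f.2 (fun i => x (Equiv.swap 0 1 i))⟩

def nabla (f : PF A) : PF A := ⟨f.1 + 1, fun x => f.2 (fun i => x i.succ)⟩

def delta (f : PF A) : PF A :=
  match f with
  | ⟨0, g⟩ => ⟨0, g⟩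
  | ⟨n+1, g⟩ => ⟨n, fun x => g (fun i => x ⟨i.val - 1, by have := i.isLt; omega⟩)⟩

/-- `f ⋆ g`. -/
def starPF (f g : PF A) : PF A :=
  ⟨f.1 + g.1, fun x =>
    (g.2 (fun j => x ⟨j.val, by have := j.isLt; omega⟩)).bind
      (fun a => f.2 (fun i =>
        if i.val = 0 then a else x ⟨g.1 + i.val, by have := i.isLt; omega⟩))⟩

/-- A partial class: closed under `ζ`, `τ`, `Δ`, `∇` and `⋆`. -/
def IsPartialClass (X : Set (PF A)) : Prop :=
  (∀ f ∈ X, zeta f ∈ X) ∧ (∀ f ∈ X, tau f ∈ X) ∧ (∀ f ∈ X, delta f ∈ X) ∧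
  (∀ f ∈ X, nabla f ∈ X) ∧ (∀ f ∈ X, ∀ g ∈ X, starPF f g ∈ X)

def starSet (X Y : Set (PF A)) : Set (PF A) := {h | ∃ f ∈ X, ∃ g ∈ Y, h = starPF f g}

/-- The constant function of arity `n+1` with value `a`. -/
def constPF (a : A) (n : ℕ) : PF A := ⟨n, fun _ => some a⟩

/-- The total clone generated by a set `G` of total functions. -/
def cloneGen (G : Set (PF A)) : Set (PF A) := ⋂₀ {C | IsClone C ∧ G ⊆ C}


/-! Boolean-specific definitions (`0 = false`, `1 = true`). -/

/-- `T_0 = Pol {(0)}`. -/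
def relT0 : Set (Fin 1 → Bool) := {fun _ => false}

/-- `T_1 = Pol {(1)}`. -/
def relT1 : Set (Fin 1 → Bool) := {fun _ => true}

/-- `{(0,0),(0,1),(1,1)}`, defining the monotone functions. -/
def relM : Set (Fin 2 → Bool) := {![false, false], ![false, true], ![true, true]}

/-- `{(0,1),(1,0)}`, defining the self-dual functions. -/
def relS : Set (Fin 2 → Bool) := {![false, true], ![true, false]}

/-- `{(x,x,y,y),(x,y,x,y),(x,y,y,x) : x,y ∈ 𝟚}`, defining the linear functions. -/
def relL : Set (Fin 4 → Bool) :=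
  {v | ∃ x y : Bool, v = ![x, x, y, y] ∨ v = ![x, y, x, y] ∨ v = ![x, y, y, x]}

def T0 : Set (PF Bool) := PolSet relT0
def T1 : Set (PF Bool) := PolSet relT1
def Mclone : Set (PF Bool) := PolSet relM
def Sclone : Set (PF Bool) := PolSet relS
def Lclone : Set (PF Bool) := PolSet relL

/-- `ρ_{0,2} = {(0,0),(0,1),(1,0)}`. -/
def rel02 : Set (Fin 2 → Bool) := {![false, false], ![false, true], ![true, false]}

/-- `T_{0,2} = Pol ρ_{0,2}`. -/
def T02 : Set (PF Bool) := PolSet rel02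

/-- Cyclic successor on `Fin n`. -/
def cyc {n : ℕ} (i : Fin n) : Fin n := ⟨(i.val + 1) % n, Nat.mod_lt _ (by have := i.isLt; omega)⟩

/-- `R^{0,2}_{C,n}`: the cyclic-graph relation. -/
def RC (n : ℕ) : Set (Fin n → Bool) := {x | ∀ i : Fin n, ![x i, x (cyc i)] ∈ rel02}

/-- `R^{0,2}_{K,n}`: the complete-graph relation. -/
def RK (n : ℕ) : Set (Fin n → Bool) := {x | ∀ i j : Fin n, i ≠ j → ![x i, x j] ∈ rel02}

/-- `R^{0,2}_n := R^{0,2}_{C,n} × R^{0,2}_{K,n} ⊆ 𝟚^{2n}`. -/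
def R02 (n : ℕ) : Set (Fin (n + n) → Bool) :=
  {x | (fun i => x (Fin.castAdd n i)) ∈ RC n ∧ (fun i => x (Fin.natAdd n i)) ∈ RK n}

/-- The binary conjunction as a partial (total) function. -/
def andPF : PF Bool := ⟨1, fun x => some (x 0 && x 1)⟩

/-- The constant Boolean functions `c_0, c_1` of all arities. -/
def constantsBool : Set (PF Bool) :=
  {f | ∃ n : ℕ, f = constPF false n ∨ f = constPF true n}

/-- `C_{01}`: the clone generated by the constants `c_0, c_1`. -/
def C01 : Set (PF Bool) := cloneGen constantsBool

/-- `Λ`: the clone generated by `∧, c_0, c_1`. -/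
def LambdaClone : Set (PF Bool) := cloneGen (insert andPF constantsBool)

/-- The monster relation `R^Λ_m ⊆ 𝟚^{m+1}` (coordinates 0-indexed: index 0 is the paper's 1). -/
def RLam (m : ℕ) : Set (Fin (m+1) → Bool) :=
  {x | (x 0 = true ∨ ∃ j : Fin (m+1), j ≠ 0 ∧ x j = false) ∧
       ∀ i j1 j2 : Fin (m+1), i ≠ 0 → j1 ≠ 0 → j2 ≠ 0 → i ≠ j1 → i ≠ j2 → j1 ≠ j2 →
         (x i = true ∨ x 0 = false ∨ x j1 = false ∨ x j2 = false)}

/-- `n(k,p) := (2k−1)p + 1`. -/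
def nkp (k p : ℕ) : ℕ := (2 * k - 1) * p + 1

/-- The `n(k,p)`-ary partial function `τ_p^k`. -/
def tauPF (k p : ℕ) : PF Bool :=
  ⟨nkp k p - 1, fun x =>
    if ∀ i, x i = true then some true
    else if (Finset.univ.filter (fun i => x i = true)).card ≤ p then some false
    else none⟩

/-- `p_1 := 1`, `p_j := n(j, p_{j−1})` for `j ≥ 2`. -/
def pseq : ℕ → ℕ
  | 0 => 1
  | 1 => 1
  | (j+2) => nkp (j+2) (pseq (j+1))

/-- `ξ_j := τ^{j+1}_{p_j}`. -/
def xi (j : ℕ) : PF Bool := tauPF (j + 1) (pseq j)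

/-- `ρ_C = {(0,0,0,0),(0,0,1,1),(0,1,0,1),(1,1,1,1)}`. -/
def rhoC : Set (Fin 4 → Bool) :=
  {![false, false, false, false], ![false, false, true, true],
   ![false, true, false, true], ![true, true, true, true]}

/-- `ρ_1 = ρ_C ∪ {(1,0,1,0),(1,1,0,0)}`. -/
def rho1 : Set (Fin 4 → Bool) :=
  rhoC ∪ {![true, false, true, false], ![true, true, false, false]}

/-- `f_a`: extension of `f` fixing the new first coordinate to `a`. -/
def extConst {A : Type} [DecidableEq A] (a : A) (f : PF A) : PF A :=
  ⟨f.1 + 1, fun x => if x 0 = a then f.2 (fun i => x i.succ) else none⟩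



theorem pres_proj {h : ℕ} (ρ : Set (Fin h → Bool)) (n : ℕ) (i : Fin (n+1)) :
    Preserves (proj n i : PF Bool) ρ := by
  intro M v hM hv
  have : v = fun k => M k i := by
    funext k
    have := hv k
    simp only [proj, Option.some.injEq] at this
    exact this.symm
  rw [this]; exact hM i

theorem compFun_some {k m : ℕ} {f : (Fin k → Bool) → Option Bool}
    {g : Fin k → ((Fin m → Bool) → Option Bool)} {x : Fin m → Bool} {a : Bool}
    (h : compFun f g x = some a) :
    ∃ y : Fin k → Bool, (∀ i, g i x = some (y i)) ∧ f y = some a := by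
  unfold compFun at h
  split_ifs at h with h'
  exact ⟨_, fun i => by simp, h⟩

theorem pres_comp {h : ℕ} (ρ : Set (Fin h → Bool)) (f : PF Bool) (hf : Preserves f ρ) (m : ℕ)
    (g : Fin (f.1+1) → ((Fin (m+1) → Bool) → Option Bool))
    (hg : ∀ i, Preserves (⟨m, g i⟩ : PF Bool) ρ) :
    Preserves (⟨m, compFun f.2 g⟩ : PF Bool) ρ := by
  intro M v hM hv
  choose y hy1 hy2 using fun k => compFun_some (hv k)
  exact hf y v (fun j => hg j M _ hM (fun k => hy1 k j)) hy2

/-- The strong partial clone of a set of indices. -/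
def XA (A : Set ℕ) : Set (PF Bool) := {f | ∀ m ∈ A, Preserves f (RLam m)}

theorem XA_clone (A : Set ℕ) : IsPartialClone (XA A) :=
  ⟨fun n i m _ => pres_proj _ n i,
   fun f hf k g hg m hm => pres_comp _ f (hf m hm) k g (fun i => hg i m hm)⟩

theorem XA_strong (A : Set ℕ) : IsStrong (XA A) := by
  apply Set.Subset.antisymm
  · rintro ⟨n, f⟩ ⟨⟨n', g⟩, hg, ⟨h, hle⟩⟩
    simp only at h
    subst h
    intro m hm M v hM hv
    exact hg m hm M v hM (fun i => hle _ _ (hv i))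
  · intro f hf
    exact ⟨f, hf, rfl, fun x a h => h⟩

theorem mem_RLam_and {m : ℕ} {x y : Fin (m+1) → Bool} (hx : x ∈ RLam m) (hy : y ∈ RLam m) :
    (fun i => x i && y i) ∈ RLam m := by
  obtain ⟨hx1, hx2⟩ := hx
  obtain ⟨hy1, hy2⟩ := hy
  refine ⟨?_, ?_⟩
  · simp only [Bool.and_eq_true, Bool.and_eq_false_iff]
    rcases hx1 with h | ⟨j, hj, h⟩
    · rcases hy1 with h' | ⟨j, hj, h'⟩
      · exact Or.inl ⟨h, h'⟩
      · exact Or.inr ⟨j, hj, Or.inr h'⟩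
    · exact Or.inr ⟨j, hj, Or.inl h⟩
  · intro i j1 j2 a b c d e g
    have h1 := hx2 i j1 j2 a b c d e g
    have h2 := hy2 i j1 j2 a b c d e g
    simp only [Bool.and_eq_true, Bool.and_eq_false_iff]
    tauto

theorem Lambda_sub (A : Set ℕ) (hA : ∀ m ∈ A, 4 ≤ m) : LambdaClone ⊆ XA A ∩ OSet Bool := by
  apply Set.sInter_subset_of_mem
  refine ⟨⟨⟨fun n i => ⟨(XA_clone A).1 n i, fun x => rfl⟩, ?_⟩, Set.inter_subset_right⟩, ?_⟩
  · intro f hf m g hg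
    refine ⟨(XA_clone A).2 f hf.1 m g (fun i => (hg i).1), ?_⟩
    intro x
    have h : ∀ i, (g i x).isSome := fun i => (hg i).2 x
    simp only [compFun, h, implies_true, dite_true]
    exact hf.2 _
  · rintro f (rfl | ⟨n, rfl | rfl⟩)
    · refine ⟨?_, fun x => rfl⟩
      intro m hm M v hM hv
      have : v = fun k => M k 0 && M k 1 := by
        funext k
        have := hv k
        simp only [andPF, Option.some.injEq] at this
        exact this.symm
      rw [this]
      exact mem_RLam_and (hM 0) (hM 1)
    · refine ⟨?_, fun x => rfl⟩
      intro m hm M v hM hv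
      have hv' : ∀ k, v k = false := by
        intro k
        have := hv k
        simp only [constPF, Option.some.injEq] at this
        exact this.symm
      have := hA m hm
      exact ⟨Or.inr ⟨⟨1, by omega⟩, by simp [Fin.ext_iff], hv' _⟩,
        fun _ _ _ _ _ _ _ _ _ => Or.inr (Or.inl (hv' _))⟩
    · refine ⟨?_, fun x => rfl⟩
      intro m hm M v hM hv
      have hv' : ∀ k, v k = true := by
        intro k
        have := hv k
        simp only [constPF, Option.some.injEq] at this
        exact this.symm
      exact ⟨Or.inl (hv' _), fun _ _ _ _ _ _ _ _ _ => Or.inl (hv' _)⟩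

theorem conj_mem {C : Set (PF Bool)} (hC : IsClone C) (hG : insert andPF constantsBool ⊆ C)
    (n : ℕ) (S : Finset (Fin (n+1))) :
    (⟨n, fun x => some (decide (∀ i ∈ S, x i = true))⟩ : PF Bool) ∈ C := by
  induction S using Finset.induction_on with
  | empty =>
    have : constPF true n ∈ C := hG (Or.inr ⟨n, Or.inr rfl⟩)
    have e : (fun x : Fin (n+1) → Bool => some (decide (∀ i ∈ (∅ : Finset (Fin (n+1))), x i = true)))
        = fun _ => some true := by funext x; simp
    rw [e]; exact this
  | insert a S ha ih =>
    have h := hC.1.2 andPF (hG (Or.inl rfl)) n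
      ![fun x => some (x a), fun x => some (decide (∀ i ∈ S, x i = true))] (by
        intro i
        change Fin 2 at i
        fin_cases i
        · exact hC.1.1 n a
        · exact ih)
    have e : (fun x : Fin (n+1) → Bool => some (decide (∀ i ∈ insert a S, x i = true))) =
        compFun (fun x : Fin 2 → Bool => some (x 0 && x 1))
          ![fun x => some (x a), fun x => some (decide (∀ i ∈ S, x i = true))] := by
      funext x
      unfold compFun
      rw [dif_pos (by intro i; fin_cases i <;> rfl)]
      simp [Bool.decide_and]
    rw [e]
    exact h

theorem total_mem (m : ℕ) (hm : 4 ≤ m) (f : PF Bool) (hp : Preserves f (RLam m))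
    (ht : IsTotalPF f) : f ∈ LambdaClone := by
  obtain ⟨n, f⟩ := f
  choose g hg using fun x => Option.isSome_iff_exists.mp (ht x)
  simp only at hg g
  have mono : ∀ x y : Fin (n+1) → Bool, (∀ i, x i = true → y i = true) → g x = true → g y = true := by
    intro x y hxy hx
    by_contra hy
    have := hp (fun k => if k = 0 then y else x) (fun k => if k = 0 then g y else g x) (by
      intro j
      refine ⟨?_, ?_⟩
      · by_cases h : y j = true
        · left; simpa using h
        · right
          refine ⟨⟨1, by omega⟩, by simp [Fin.ext_iff], ?_⟩
          have := hxy j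
          simp [Fin.ext_iff]
          cases hh : x j <;> simp_all
      · intro i j1 j2 a b c d e g
        simp only [a, b, if_false]
        cases x j <;> simp) (by
      intro i; dsimp only; split_ifs <;> exact hg _)
    rcases this.1 with h | ⟨j, hj, h⟩
    · simp at h; exact hy h
    · simp [hj, hx] at h
  have conj : ∀ x y : Fin (n+1) → Bool, g x = true → g y = true → g (fun i => x i && y i) = true := by
    intro x y hx hy
    by_contra hz
    let z : Fin (n+1) → Bool := fun i => x i && y i
    have := hp (fun k => if k = 0 then z else if k.val = 1 then x else y)
      (fun k => if k = 0 then g z else if k.val = 1 then g x else g y) (by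
      intro j
      refine ⟨?_, ?_⟩
      · by_cases h : x j = true
        · by_cases h' : y j = true
          · left; simp [z, h, h']
          · right
            refine ⟨⟨2, by omega⟩, by simp [Fin.ext_iff], ?_⟩
            simpa [Fin.ext_iff] using h'
        · right
          refine ⟨⟨1, by omega⟩, by simp [Fin.ext_iff], ?_⟩
          simpa [Fin.ext_iff] using h
      · intro i j1 j2 a b c d e g
        simp only [a, b, c, if_false, if_true, z]
        split_ifs <;> cases hxj : x j <;> cases hyj : y j <;> simp [hxj, hyj]) (by
      intro i; dsimp only; split_ifs <;> exact hg _)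
    rcases this.1 with h | ⟨j, hj, h⟩
    · simp at h; exact hz h
    · simp only [hj, if_false] at h
      split_ifs at h <;> simp_all
  intro C hC
  obtain ⟨hC, hG⟩ := hC
  have hfg : f = fun x => some (g x) := funext hg
  by_cases h1 : g (fun _ => true) = true
  · let S : Finset (Fin (n+1)) := Finset.univ.filter (fun i => g (fun k => decide (k ≠ i)) = false)
    have key : ∀ x, g x = decide (∀ i ∈ S, x i = true) := by
      intro x
      rw [Bool.eq_iff_iff, decide_eq_true_iff]
      constructor
      · intro hx i hi
        by_contra hxi
        have : g (fun k => decide (k ≠ i)) = true := by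
          refine mono x _ ?_ hx
          intro k hk
          simp only [decide_eq_true_iff]
          rintro rfl
          exact hxi hk
        simp [S] at hi
        simp_all
      · intro hx
        have : ∀ T : Finset (Fin (n+1)), (∀ i ∈ T, i ∉ S) → g (fun k => decide (k ∉ T)) = true := by
          intro T
          induction T using Finset.induction_on with
          | empty => intro _; simpa using h1
          | insert a T ha ih =>
            intro hT
            have h2 := ih (fun i hi => hT i (Finset.mem_insert_of_mem hi))
            have h3 : g (fun k => decide (k ≠ a)) = true := by
              have := hT a (Finset.mem_insert_self _ _)
              simpa [S] using this
            have h4 := conj _ _ h3 h2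
            convert h4 using 2
            funext k
            simp
        have h5 := this (Finset.univ.filter (fun i => x i = false)) (by
          intro i hi hiS
          have := hx i hiS
          simp at hi
          simp_all)
        convert h5 using 2
        funext k
        simp
    have := conj_mem hC hG n S
    rw [hfg]
    simp only [key]
    exact this
  · have : ∀ x, g x = false := by
      intro x
      by_contra hx
      exact h1 (mono x _ (fun _ _ => rfl) (by simpa using hx))
    rw [hfg]
    simp only [this]
    exact hG (Or.inr ⟨n, Or.inl rfl⟩)

theorem XA_mem (A : Set ℕ) (hA : ∀ m ∈ A, 4 ≤ m) (h4 : 4 ∈ A) : XA A ∈ Istr LambdaClone := by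
  refine ⟨XA_clone A, XA_strong A, Set.Subset.antisymm ?_ (Lambda_sub A hA)⟩
  rintro f ⟨hf, ht⟩
  exact total_mem 4 le_rfl f (hf 4 h4) ht

theorem minor_lemma {a m : ℕ} (hm : 4 ≤ m) (σ : Fin (a+1) → Fin (m+1))
    (hσ : ∀ x ∈ RLam m, (fun i => x (σ i)) ∈ RLam a) (ham : a ≠ m) :
    (fun i => decide (σ i ≠ 0)) ∈ RLam a := by
  have zero_mem : ∀ x : Fin (m+1) → Bool, x 0 = false → (∃ j, j ≠ 0 ∧ x j = false) → x ∈ RLam m :=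
    fun x h h' => ⟨Or.inr h', fun _ _ _ _ _ _ _ _ _ => Or.inr (Or.inl h)⟩
  refine ⟨?_, ?_⟩
  · by_contra hcon
    push Not at hcon
    obtain ⟨h0, hj⟩ := hcon
    have h0 : σ 0 = 0 := by simpa using h0
    have hj : ∀ j, j ≠ 0 → σ j ≠ 0 := by
      intro j hj0
      have := hj j hj0
      simpa using this
    have surj : ∀ p, p ≠ 0 → ∃ i, i ≠ 0 ∧ σ i = p := by
      intro p hp
      by_contra hno
      push Not at hno
      have := hσ (fun k => decide (k ≠ 0 ∧ k ≠ p)) (zero_mem _ (by simp) ⟨p, hp, by simp⟩)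
      rcases this.1 with h | ⟨j, hj0, h⟩
      · simp [h0] at h
      · simp at h
        exact hno j hj0 (h (hj j hj0))
    have inj : ∀ j1 j2, j1 ≠ 0 → j2 ≠ 0 → σ j1 = σ j2 → j1 = j2 := by
      intro j1 j2 h1 h2 he
      by_contra hne
      obtain ⟨q, hq0, hq⟩ : ∃ q : Fin (m+1), q ≠ 0 ∧ q ≠ σ j1 := by
        by_cases h : σ j1 = ⟨1, by omega⟩
        · exact ⟨⟨2, by omega⟩, by simp [Fin.ext_iff], by rw [h]; simp [Fin.ext_iff]⟩
        · exact ⟨⟨1, by omega⟩, by simp [Fin.ext_iff], fun h' => h h'.symm⟩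
      obtain ⟨i, hi0, hi⟩ := surj q hq0
      have := hσ (fun k => decide (k = 0 ∨ k = σ j1)) ⟨Or.inl (by simp), by
        intro i k1 k2 a b c d e g
        by_cases hk : k1 = σ j1
        · right; right; right
          simp only [decide_eq_false_iff_not, not_or]
          exact ⟨c, fun h => g (hk.trans h.symm)⟩
        · right; right; left
          simp only [decide_eq_false_iff_not, not_or]
          exact ⟨b, hk⟩⟩
      have := this.2 i j1 j2 hi0 h1 h2 (by rintro rfl; exact hq hi.symm)
        (by rintro rfl; exact hq (hi.symm.trans he.symm)) hne
      simp [h0, hi, he] at this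
      rw [he] at hq
      rcases this with h | h
      · exact hq0 h
      · exact hq h
    have bij : Function.Bijective σ := by
      constructor
      · intro j1 j2 he
        by_cases h1 : j1 = 0
        · by_cases h2 : j2 = 0
          · rw [h1, h2]
          · exact absurd (by rw [← he, h1, h0]) (hj j2 h2)
        · by_cases h2 : j2 = 0
          · exact absurd (by rw [he, h2, h0]) (hj j1 h1)
          · exact inj j1 j2 h1 h2 he
      · intro p
        by_cases hp : p = 0
        · exact ⟨0, by rw [h0, hp]⟩
        · obtain ⟨i, _, hi⟩ := surj p hp
          exact ⟨i, hi⟩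
    have := Fintype.card_of_bijective bij
    simp at this
    exact ham this
  · intro i j1 j2 hi hj1 hj2 h1 h2 h3
    by_contra hcon
    push Not at hcon
    simp only [ne_eq, decide_not, Bool.not_eq_true, Bool.not_eq_false, Bool.not_eq_eq_eq_not, Bool.not_true, Bool.not_false, decide_eq_true_eq, decide_eq_false_iff_not] at hcon
    obtain ⟨ci, c0, c1, c2⟩ := hcon
    have hex : ∃ q : Fin (m+1), q ∉ ({0, σ 0, σ j1, σ j2} : Finset (Fin (m+1))) := by
      by_contra hno
      push Not at hno
      have hc : (Finset.univ : Finset (Fin (m+1))).card ≤ ({0, σ 0, σ j1, σ j2} : Finset (Fin (m+1))).card :=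
        Finset.card_le_card (fun q _ => hno q)
      have := hc.trans Finset.card_le_four
      simp at this
      omega
    obtain ⟨q, hq⟩ := hex
    simp only [Finset.mem_insert, Finset.mem_singleton, not_or] at hq
    have := hσ (fun k => decide (k = σ 0 ∨ k = σ j1 ∨ k = σ j2)) (zero_mem _ (by
      simp only [decide_eq_false_iff_not, not_or]
      exact ⟨fun h => c0 h.symm, fun h => c1 h.symm, fun h => c2 h.symm⟩) ⟨q, hq.1, by
      simp only [decide_eq_false_iff_not, not_or]; exact hq.2⟩)
    have := this.2 i j1 j2 hi hj1 hj2 h1 h2 h3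
    simp [ci] at this
    rcases this with h | h | h
    · exact c0 (h.symm.trans (not_not.mp ci))
    · exact c1 (h.symm.trans (not_not.mp ci))
    · exact c2 (h.symm.trans (not_not.mp ci))

theorem exists_sep (m : ℕ) (hm : 4 ≤ m) :
    ∃ f : PF Bool, ¬ Preserves f (RLam m) ∧ ∀ a, a ≠ m → Preserves f (RLam a) := by
  classical
  obtain ⟨n, e, he⟩ : ∃ (n : ℕ) (e : Fin (n+1) → (Fin (m+1) → Bool)), Set.range e = RLam m := by
    have hne : (fun _ => true) ∈ RLam m := ⟨Or.inl rfl, fun _ _ _ _ _ _ _ _ _ => Or.inl rfl⟩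
    have : Nonempty (RLam m) := ⟨⟨_, hne⟩⟩
    obtain ⟨k, hk⟩ := Nat.exists_eq_succ_of_ne_zero (Fintype.card_ne_zero (α := RLam m))
    let E := (Fintype.equivFinOfCardEq hk).symm
    refine ⟨k, fun i => (E i).1, ?_⟩
    ext x
    constructor
    · rintro ⟨i, rfl⟩; exact (E i).2
    · intro hx; exact ⟨E.symm ⟨x, hx⟩, by simp⟩
  let row : Fin (m+1) → Fin (n+1) → Bool := fun i c => e c i
  let f : (Fin (n+1) → Bool) → Option Bool := fun x =>
    if x = row 0 then some false else if ∃ i, i ≠ 0 ∧ x = row i then some true else none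
  refine ⟨⟨n, f⟩, ?_, ?_⟩
  · intro hp
    have := hp row (fun i => decide (i ≠ 0)) (fun j => by
      rw [← he]; exact ⟨j, rfl⟩) (by
      intro i
      by_cases hi : i = 0
      · simp [hi, f]
      · have hne : row i ≠ row 0 := by
          have hx : (fun k => decide (k = i)) ∈ RLam m := by
            refine ⟨Or.inr ?_, fun _ _ _ _ _ _ _ _ _ => Or.inr (Or.inl (by simpa using fun h => hi h.symm))⟩
            by_cases h : i = ⟨1, by omega⟩
            · exact ⟨⟨2, by omega⟩, by simp [Fin.ext_iff], by rw [h]; simp [Fin.ext_iff]⟩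
            · exact ⟨⟨1, by omega⟩, by simp [Fin.ext_iff], by simpa using fun h' => h h'.symm⟩
          rw [← he] at hx
          obtain ⟨c, hc⟩ := hx
          intro heq
          have := congrFun heq c
          simp only [row, hc] at this
          simp at this
          exact hi this.symm
        have hex : ∃ k, k ≠ 0 ∧ row i = row k := ⟨i, hi, rfl⟩
        simp only [f]
        rw [if_neg hne, if_pos hex]
        simp [hi])
    rcases this.1 with h | ⟨j, hj, h⟩
    · simp at h
    · simp [hj] at h
  · intro a ham M v hM hv
    have hs : ∀ k, ∃ s, M k = row s ∧ v k = decide (s ≠ 0) := by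
      intro k
      have := hv k
      simp only [f] at this
      split_ifs at this with h1 h2
      · exact ⟨0, h1, by simpa using this.symm⟩
      · obtain ⟨i, hi, h⟩ := h2
        exact ⟨i, h, by simpa [hi] using this.symm⟩
    choose σ h1 h2 using hs
    have hv' : v = fun i => decide (σ i ≠ 0) := funext h2
    rw [hv']
    refine minor_lemma hm σ ?_ ham
    intro x hx
    rw [← he] at hx
    obtain ⟨c, rfl⟩ := hx
    have := hM c
    simp only [h1] at this
    exact this

theorem XA_inj : Function.Injective
    (fun S : Set ℕ => XA (insert 4 ((fun n => n + 5) '' S))) := by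
  have key : ∀ S T : Set ℕ, XA (insert 4 ((fun n => n + 5) '' S)) = XA (insert 4 ((fun n => n + 5) '' T)) →
      S ⊆ T := by
    intro S T h n hn
    by_contra hnT
    obtain ⟨f, hf1, hf2⟩ := exists_sep (n+5) (by omega)
    have hT : f ∈ XA (insert 4 ((fun n => n + 5) '' T)) := by
      rintro a (rfl | ⟨b, hb, rfl⟩)
      · exact hf2 _ (by omega)
      · refine hf2 _ ?_
        intro h
        have : b = n := by simpa using h
        exact hnT (this ▸ hb)
    rw [← h] at hT
    exact hf1 (hT _ (Or.inr ⟨n, hn, rfl⟩))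
  intro S T h
  exact Set.Subset.antisymm (key S T h) (key T S h.symm)

instance countable_PF : Countable (PF Bool) := by
  unfold PF; infer_instance

theorem Istr_Lambda_continuum : Cardinal.mk ↥(Istr LambdaClone) = Cardinal.continuum := by
  apply le_antisymm
  · calc Cardinal.mk ↥(Istr LambdaClone) ≤ Cardinal.mk (Set (PF Bool)) := Cardinal.mk_set_le _
      _ = 2 ^ Cardinal.mk (PF Bool) := Cardinal.mk_set
      _ ≤ 2 ^ Cardinal.aleph0 := Cardinal.power_le_power_left two_ne_zero (Cardinal.mk_le_aleph0)
      _ = Cardinal.continuum := Cardinal.two_power_aleph0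
  · have h : Cardinal.mk (Set ℕ) = Cardinal.continuum := by simp
    rw [← h]
    refine Cardinal.mk_le_of_injective
      (f := fun S : Set ℕ => (⟨XA (insert 4 ((fun n => n + 5) '' S)), XA_mem _ ?_ (Or.inl rfl)⟩ :
        ↥(Istr LambdaClone))) ?_
    · rintro m (rfl | ⟨n, _, rfl⟩) <;> simp
    · intro S T h
      exact XA_inj (congrArg Subtype.val h)

end StrongPartial
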